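/- Let (V, R, α ↦ α∨) be a reduced crystallographic root system whose roots span V*, with Weyl group W. Fix a base Δ ⊆ R (a set of simple roots), with corresponding positive roots R₊ and negative roots R₋ = −R₊. Let S ⊆ Δ, let W_H ≤ W be the subgroup generated by { s_α : α ∈ S }, let R_H := R ∩ (ℤ-span of S), and let N := R₋ \ R_H. Let Λ ⊆ V* be a subgroup with R ⊆ Λ and λ(α∨) ∈ ℤ for all λ ∈ Λ and α ∈ R (so W preserves Λ). Let ℤ[Λ] denote the group ring of Λ, with ℤ-basis { e^λ : λ ∈ Λ } and e^λ e^μ = e^{λ+μ}; it is an integral domain, W acts on it by ring automorphisms e^λ ↦ e^{w(λ)}, and this action extends to its fraction field Q. Set D := ∏_{α ∈ N} (1 − e^α) ∈ ℤ[Λ], a non-zero element. Then: (i) u(D) = D for every u ∈ W_H; (ii) for every f ∈ ℤ[Λ] fixed by all elements of W_H, the element w(f·D⁻¹) ∈ Q depends only on the left coset wW_H, and the finite sum ind(f) := Σ_{[w] ∈ W/W_H} w(f·D⁻¹) lies in the canonical image of ℤ[Λ] in Q and is fixed by every element of W. -/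

import Mathlib

open Module

/-- A reduced crystallographic root system on a real vector space `V`:
the roots are a finite set of non-zero linear functionals on `V`, each root `α`
has a coroot `α∨ ∈ V` with `α(α∨) = 2`, pairings of roots with coroots are
integers, the reflections `s_α : x ↦ x - α(x)·α∨` (resp. their dual actions
`λ ↦ λ - λ(α∨)·α`) permute the coroots (resp. the roots), and the only roots
proportional to a root `α` are `±α`. -/
structure RedCrystRootSystem (V : Type*) [AddCommGroup V] [Module ℝ V] where
  R : Finset (Module.Dual ℝ V)
  coroot : Module.Dual ℝ V → V
  ne_zero : ∀ α ∈ R, α ≠ 0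
  root_coroot_two : ∀ α ∈ R, α (coroot α) = 2
  crystallographic : ∀ α ∈ R, ∀ β ∈ R, ∃ n : ℤ, β (coroot α) = (n : ℝ)
  refl_root_mem : ∀ α ∈ R, ∀ β ∈ R, β - β (coroot α) • α ∈ R
  refl_coroot_mem : ∀ α ∈ R, ∀ β ∈ R,
    ∃ γ ∈ R, coroot β - α (coroot β) • coroot α = coroot γ
  reduced : ∀ α ∈ R, ∀ β ∈ R, ∀ c : ℝ, β = c • α → β = α ∨ β = -α

namespace RedCrystRootSystem

variable {V : Type*} [AddCommGroup V] [Module ℝ V] (S : RedCrystRootSystem V)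

/-- The reflection `s_α : x ↦ x - α(x)·α∨` associated to a root `α`, as a linear map. -/
def reflMap (α : Module.Dual ℝ V) : V →ₗ[ℝ] V :=
  LinearMap.id - α.smulRight (S.coroot α)

@[simp] lemma reflMap_apply (α : Module.Dual ℝ V) (x : V) :
    S.reflMap α x = x - α x • S.coroot α := rfl

/-- A linear automorphism of `V` is a reflection of the root system if it is
given by `x ↦ x - α(x)·α∨` for some root `α`. -/
def IsReflection (e : V ≃ₗ[ℝ] V) : Prop :=
  ∃ α ∈ S.R, ∀ x : V, e x = x - α x • S.coroot α

/-- The Weyl group: the subgroup of linear automorphisms of `V` generated by the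
reflections `s_α`, `α ∈ R`. -/
def weylGroup : Subgroup (V ≃ₗ[ℝ] V) :=
  Subgroup.closure {e : V ≃ₗ[ℝ] V | S.IsReflection e}

/-- The coroot lattice `Q∨`: the additive subgroup of `V` generated by the coroots. -/
def corootLattice : AddSubgroup V :=
  AddSubgroup.closure (S.coroot '' ↑S.R)

end RedCrystRootSystem

/-- `e` fixes the point `t` of the torus `V ⧸ Λ`. This is expressed by asking for an
additive endomorphism of `V ⧸ Λ` covering `e` (which exists iff `e` preserves `Λ`,
and is then unique) fixing `t`. -/
def FixesInTorus {V : Type*} [AddCommGroup V] [Module ℝ V]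
    (Λ : AddSubgroup V) (e : V ≃ₗ[ℝ] V) (t : V ⧸ Λ) : Prop :=
  ∃ f : (V ⧸ Λ) →+ (V ⧸ Λ),
    (∀ x : V, f (QuotientAddGroup.mk x) = QuotientAddGroup.mk (e x)) ∧ f t = t

namespace RedCrystRootSystem

variable {V : Type*} [AddCommGroup V] [Module ℝ V] (S : RedCrystRootSystem V)

/-- `Δ` is a base (a set of simple roots) of the root system: a linearly independent
set of roots such that every root is a ℤ-linear combination of elements of `Δ` with
either all coefficients nonnegative or all coefficients nonpositive. -/
def IsBase (Δ : Finset (Module.Dual ℝ V)) : Prop :=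
  (↑Δ : Set (Module.Dual ℝ V)) ⊆ ↑S.R ∧
  LinearIndependent ℝ (fun a : (Δ : Set (Module.Dual ℝ V)) => (a : Module.Dual ℝ V)) ∧
  ∀ β ∈ S.R,
    (∃ c : Module.Dual ℝ V → ℤ, β = ∑ α ∈ Δ, (c α : ℝ) • α ∧ ∀ α ∈ Δ, 0 ≤ c α) ∨
    (∃ c : Module.Dual ℝ V → ℤ, β = ∑ α ∈ Δ, (c α : ℝ) • α ∧ ∀ α ∈ Δ, c α ≤ 0)

/-- The positive roots relative to a base `Δ`. -/
def posRoots (Δ : Finset (Module.Dual ℝ V)) : Set (Module.Dual ℝ V) :=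
  {β | β ∈ S.R ∧
    ∃ c : Module.Dual ℝ V → ℤ, β = ∑ α ∈ Δ, (c α : ℝ) • α ∧ ∀ α ∈ Δ, 0 ≤ c α}

/-- The negative roots relative to a base `Δ`. -/
def negRoots (Δ : Finset (Module.Dual ℝ V)) : Set (Module.Dual ℝ V) :=
  {β | β ∈ S.R ∧ -β ∈ S.posRoots Δ}

/-- The subgroup `W_H` of the Weyl group generated by the reflections `s_α`, `α ∈ S₀`,
associated to a subset `S₀` of the simple roots. -/
def parabolic (S₀ : Finset (Module.Dual ℝ V)) : Subgroup (V ≃ₗ[ℝ] V) :=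
  Subgroup.closure {e : V ≃ₗ[ℝ] V | ∃ α ∈ S₀, ∀ x : V, e x = x - α x • S.coroot α}

end RedCrystRootSystem

open scoped Classical in
/-- The basis element `e^μ` of the group ring `ℤ[Λ]` attached to `μ ∈ Λ`
(and `0` if `μ ∉ Λ`). -/
noncomputable def expElt {V : Type*} [AddCommGroup V] [Module ℝ V]
    (Λ : AddSubgroup (Module.Dual ℝ V)) (μ : Module.Dual ℝ V) :
    AddMonoidAlgebra ℤ ↥Λ :=
  if h : μ ∈ Λ then AddMonoidAlgebra.single (⟨μ, h⟩ : ↥Λ) 1 else 0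

namespace AddMonoidAlgebra

variable {G M : Type*} [AddCommGroup G] [AddCommGroup M]

/-- An additive subgroup of the integral group ring containing every basis element is everything. -/
lemma mem_addSubgroup_of_single_mem (P : AddSubgroup (AddMonoidAlgebra ℤ G))
    (hP : ∀ g : G, single g (1 : ℤ) ∈ P) (x : AddMonoidAlgebra ℤ G) : x ∈ P := by
  induction x using AddMonoidAlgebra.induction_on with
  | of g => exact hP g
  | add x y hx hy => exact P.add_mem hx hy
  | smul r x hx => exact P.zsmul_mem hx r

lemma one_sub_single_dvd_one_sub_single_nsmul (a : G) (n : ℕ) :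
    (1 : AddMonoidAlgebra ℤ G) - single a 1 ∣ 1 - single (n • a) 1 := by
  simpa [single_pow] using sub_dvd_pow_sub_pow (1 : AddMonoidAlgebra ℤ G) (single a 1) n

lemma single_sub_single_eq (g h : G) :
    (single g 1 - single h 1 : AddMonoidAlgebra ℤ G) = single g 1 * (1 - single (h - g) 1) := by
  simp [mul_sub, single_mul_single]

lemma single_sub_single_eq' (g h : G) :
    (single g 1 - single h 1 : AddMonoidAlgebra ℤ G) = -(single h 1 * (1 - single (g - h) 1)) := by
  simp [mul_sub, single_mul_single]

lemma one_sub_single_dvd_single_sub_single {a g h : G} (hgh : g - h ∈ AddSubgroup.zmultiples a) :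
    (1 : AddMonoidAlgebra ℤ G) - single a 1 ∣ single g 1 - single h 1 := by
  obtain ⟨n, hn⟩ := AddSubgroup.mem_zmultiples_iff.1 hgh
  obtain ⟨k, rfl | rfl⟩ := n.eq_nat_or_neg
  · rw [single_sub_single_eq', ← hn, natCast_zsmul, dvd_neg]
    exact (one_sub_single_dvd_one_sub_single_nsmul a k).mul_left _
  · rw [single_sub_single_eq, ← neg_sub g h, ← hn, neg_smul, neg_neg, natCast_zsmul]
    exact (one_sub_single_dvd_one_sub_single_nsmul a k).mul_left _

/-- If an additive endomorphism of the integral group ring moves each basis element within its coset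
modulo `ℤa`, it is congruent to the identity modulo `1 - e^a`. -/
lemma one_sub_single_dvd_sub_map {a : G} (φ : AddMonoidAlgebra ℤ G →+ AddMonoidAlgebra ℤ G)
    (hφ : ∀ g, ∃ h, φ (single g 1) = single h 1 ∧ g - h ∈ AddSubgroup.zmultiples a)
    (x : AddMonoidAlgebra ℤ G) : 1 - single a 1 ∣ x - φ x := by
  have := mem_addSubgroup_of_single_mem (((Ideal.span {(1 : AddMonoidAlgebra ℤ G) - single a 1}
    ).toAddSubgroup).comap (AddMonoidHom.id _ - φ)) (fun g ↦ by
      obtain ⟨h, h1, h2⟩ := hφ g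
      simpa [h1, Ideal.mem_span_singleton] using one_sub_single_dvd_single_sub_single h2) x
  simpa [Ideal.mem_span_singleton] using this

lemma one_sub_single_dvd_iff (a : G) (x : AddMonoidAlgebra ℤ G) :
    1 - single a 1 ∣ x ↔
      mapDomainRingHom ℤ (QuotientAddGroup.mk' (AddSubgroup.zmultiples a)) x = 0 := by
  set π := QuotientAddGroup.mk' (AddSubgroup.zmultiples a)
  constructor
  · rintro ⟨y, rfl⟩
    have : π a = 0 := by simp [π]
    rw [map_mul, map_sub, map_one, mapDomainRingHom_apply, mapDomain_single, this, one_def,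
      sub_self, zero_mul]
  · intro hx
    let φ : AddMonoidAlgebra ℤ G →+ AddMonoidAlgebra ℤ G :=
      { toFun := fun y ↦ mapDomain Quotient.out (mapDomain π y)
        map_zero' := by simp
        map_add' := by simp [mapDomain_add] }
    have h0 : φ x = 0 := by
      rw [mapDomainRingHom_apply] at hx
      simp [φ, hx]
    have := one_sub_single_dvd_sub_map (a := a) φ (fun g ↦ ⟨(π g).out, by simp [φ], by
      rw [← QuotientAddGroup.eq_iff_sub_mem]
      exact (QuotientAddGroup.out_eq' (π g)).symm⟩) x
    simpa [h0] using this

lemma eq_zero_of_one_sub_single_mul_eq_zero {m : M} (hm : ∀ k : ℕ, k ≠ 0 → k • m ≠ 0)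
    {x : AddMonoidAlgebra ℤ M} (hx : (1 - single m 1) * x = 0) : x = 0 := by
  have hstep : ∀ g, x.coeff (m + g) = x.coeff g := fun g ↦ by
    have h : x = single m 1 * x := by rw [sub_mul, one_mul, sub_eq_zero] at hx; exact hx
    conv_lhs => rw [h]
    simp [coeff_single_mul_apply]
  have hiter : ∀ (k : ℕ) g, x.coeff (k • m + g) = x.coeff g := fun k g ↦ by
    induction k with
    | zero => simp
    | succ k ih => rw [succ_nsmul', add_assoc, hstep, ih]
  by_contra hne
  obtain ⟨g, hg⟩ : ∃ g, x.coeff g ≠ 0 := by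
    by_contra! h
    exact hne (by ext g; simp [h])
  have hinj : Function.Injective fun k : ℕ ↦ k • m + g := by
    intro k l hkl
    replace hkl : k • m = l • m := add_right_cancel hkl
    wlog hle : k ≤ l generalizing k l
    · exact (this hkl.symm (le_of_not_ge hle)).symm
    by_contra hne
    refine hm (l - k) (by omega) ?_
    rw [sub_nsmul _ hle, hkl, add_neg_cancel]
  refine Set.infinite_range_of_injective hinj (x.coeff.support.finite_toSet.subset ?_)
  rintro _ ⟨k, rfl⟩
  simpa [hiter] using hg

/-- If `b` has infinite order modulo `ℤa`, then `1 - e^b` is a nonzerodivisor modulo `1 - e^a`. -/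
lemma one_sub_single_dvd_of_dvd_mul {a b : G}
    (hab : ∀ k : ℕ, k ≠ 0 → k • b ∉ AddSubgroup.zmultiples a) {x : AddMonoidAlgebra ℤ G}
    (hx : 1 - single a 1 ∣ (1 - single b 1) * x) : 1 - single a 1 ∣ x := by
  rw [one_sub_single_dvd_iff] at hx ⊢
  rw [map_mul, map_sub, map_one, mapDomainRingHom_apply _ _ (single b 1), mapDomain_single] at hx
  refine eq_zero_of_one_sub_single_mul_eq_zero (fun k hk h ↦ hab k hk ?_) hx
  rwa [← map_nsmul, QuotientAddGroup.mk'_apply, QuotientAddGroup.eq_zero_iff] at h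

lemma one_sub_single_dvd_of_dvd_two_mul {a : G} {x : AddMonoidAlgebra ℤ G}
    (hx : 1 - single a 1 ∣ 2 * x) : 1 - single a 1 ∣ x := by
  rw [one_sub_single_dvd_iff] at hx ⊢
  rw [map_mul, map_ofNat, two_mul] at hx
  ext g
  have := congrArg (fun y ↦ y.coeff g) hx
  simp only [coeff_add, Finsupp.add_apply, coeff_zero, Finsupp.zero_apply] at this ⊢
  omega

end AddMonoidAlgebra

/-- Descent for denominators: if `E` becomes integral after clearing the denominators `d γ`, `γ ∈ R`,
and for each `γ` it also has a denominator that is a nonzerodivisor modulo `d γ`,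
then `E` is integral. -/
lemma mem_range_algebraMap_of_coprime_denominators {ι A Q : Type*} [CommRing A] [Field Q]
    [Algebra A Q] (hinj : Function.Injective (algebraMap A Q)) (R : Finset ι) (d : ι → A) (E : Q)
    (hd : ∀ γ ∈ R, d γ ≠ 0)
    (hE : E * algebraMap A Q (∏ γ ∈ R, d γ) ∈ (algebraMap A Q).range)
    (hc : ∀ γ ∈ R, ∃ c : A, E * algebraMap A Q c ∈ (algebraMap A Q).range ∧
      ∀ x, d γ ∣ c * x → d γ ∣ x) :
    E ∈ (algebraMap A Q).range := by
  induction R using Finset.cons_induction with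
  | empty => simpa using hE
  | cons γ T hγ ih =>
    refine ih (fun β hβ ↦ hd β (Finset.mem_cons_of_mem hβ)) ?_
      fun β hβ ↦ hc β (Finset.mem_cons_of_mem hβ)
    obtain ⟨c, ⟨y, hy⟩, hcdvd⟩ := hc γ (Finset.mem_cons_self γ T)
    obtain ⟨x, hx⟩ := hE
    have hxc : c * x = d γ * (y * ∏ β ∈ T, d β) := hinj (by
      rw [Finset.prod_cons] at hx
      simp only [map_mul, hx, hy]
      ring)
    obtain ⟨z, rfl⟩ := hcdvd x ⟨_, hxc⟩
    refine ⟨z, ?_⟩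
    have hne : algebraMap A Q (d γ) ≠ 0 :=
      (map_ne_zero_iff _ hinj).2 (hd γ (Finset.mem_cons_self γ T))
    refine mul_left_cancel₀ hne ?_
    rw [← map_mul, hx, Finset.prod_cons, map_mul]
    ring

section ExpElt

variable {V : Type*} [AddCommGroup V] [Module ℝ V] {Λ : AddSubgroup (Module.Dual ℝ V)}
  {μ ν : Module.Dual ℝ V}

lemma expElt_of_mem (h : μ ∈ Λ) : expElt Λ μ = AddMonoidAlgebra.single ⟨μ, h⟩ 1 := dif_pos h

lemma one_sub_expElt_neg (h : μ ∈ Λ) :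
    1 - expElt Λ (-μ) = -expElt Λ (-μ) * (1 - expElt Λ μ) := by
  rw [expElt_of_mem h, expElt_of_mem (Λ.neg_mem h), mul_sub, mul_one, neg_mul,
    AddMonoidAlgebra.single_mul_single]
  simp only [AddMemClass.mk_add_mk, neg_add_cancel, mul_one, AddMonoidAlgebra.one_def]
  rw [show (⟨0, _⟩ : Λ) = 0 from rfl]
  abel

lemma one_sub_expElt_neg_dvd (h : μ ∈ Λ) : 1 - expElt Λ (-μ) ∣ 1 - expElt Λ μ := by
  have := one_sub_expElt_neg (Λ.neg_mem h)
  rw [neg_neg] at this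
  exact ⟨_, this.trans (mul_comm _ _)⟩

lemma one_sub_expElt_ne_zero (h : μ ∈ Λ) (hμ : μ ≠ 0) : 1 - expElt Λ μ ≠ 0 := by
  rw [expElt_of_mem h, sub_ne_zero, AddMonoidAlgebra.one_def, ne_eq,
    AddMonoidAlgebra.single_left_inj one_ne_zero, eq_comm]
  simpa [Subtype.ext_iff] using hμ

lemma one_sub_expElt_dvd_of_dvd_mul (hμ : μ ∈ Λ) (hν : ν ∈ Λ) (h : ∀ c : ℝ, ν ≠ c • μ)
    {x : AddMonoidAlgebra ℤ Λ} (hx : 1 - expElt Λ μ ∣ (1 - expElt Λ ν) * x) :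
    1 - expElt Λ μ ∣ x := by
  rw [expElt_of_mem hμ, expElt_of_mem hν] at hx
  rw [expElt_of_mem hμ]
  refine AddMonoidAlgebra.one_sub_single_dvd_of_dvd_mul (fun k hk hmem ↦ ?_) hx
  obtain ⟨n, hn⟩ := AddSubgroup.mem_zmultiples_iff.1 hmem
  have hn : n • μ = k • ν := congrArg Subtype.val hn
  refine h ((k : ℝ)⁻¹ * n) ?_
  rw [mul_smul, Int.cast_smul_eq_zsmul, hn, ← Nat.cast_smul_eq_nsmul ℝ k, smul_smul,
    inv_mul_cancel₀ (by exact_mod_cast hk), one_smul]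

end ExpElt

namespace RedCrystRootSystem

variable {V : Type*} [AddCommGroup V] [Module ℝ V]

/-- The dual action `μ ↦ μ ∘ w⁻¹` of linear automorphisms on functionals. -/
def dualAct (w : V ≃ₗ[ℝ] V) (μ : Module.Dual ℝ V) : Module.Dual ℝ V :=
  μ.comp ((w⁻¹ : V ≃ₗ[ℝ] V) : V →ₗ[ℝ] V)

lemma dualAct_one (μ : Module.Dual ℝ V) : dualAct 1 μ = μ := by
  ext x; simp [dualAct]

lemma dualAct_mul (w w' : V ≃ₗ[ℝ] V) (μ : Module.Dual ℝ V) :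
    dualAct (w * w') μ = dualAct w (dualAct w' μ) := by
  ext x; simp [dualAct]

lemma dualAct_neg (w : V ≃ₗ[ℝ] V) (μ : Module.Dual ℝ V) : dualAct w (-μ) = -dualAct w μ := rfl

lemma dualAct_inv_dualAct (w : V ≃ₗ[ℝ] V) (μ : Module.Dual ℝ V) :
    dualAct w⁻¹ (dualAct w μ) = μ := by
  rw [← dualAct_mul, inv_mul_cancel, dualAct_one]

lemma dualAct_injective (w : V ≃ₗ[ℝ] V) : Function.Injective (dualAct w) :=
  Function.LeftInverse.injective (dualAct_inv_dualAct w)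

/-- A set of functionals stable under a set of involutions is stable under the subgroup they
generate. -/
lemma dualAct_mem_of_mem_closure {G : Set (V ≃ₗ[ℝ] V)} {X : Set (Module.Dual ℝ V)}
    (hinv : ∀ e ∈ G, e⁻¹ = e) (hX : ∀ e ∈ G, ∀ μ ∈ X, dualAct e μ ∈ X) {w : V ≃ₗ[ℝ] V}
    (hw : w ∈ Subgroup.closure G) : ∀ μ ∈ X, dualAct w μ ∈ X := by
  suffices ∀ μ ∈ X, dualAct w μ ∈ X ∧ dualAct w⁻¹ μ ∈ X from fun μ hμ ↦ (this μ hμ).1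
  induction hw using Subgroup.closure_induction with
  | mem e he => exact fun μ hμ ↦ ⟨hX e he μ hμ, (hinv e he).symm ▸ hX e he μ hμ⟩
  | one => simp [dualAct_one]
  | mul x y _ _ hx hy =>
    intro μ hμ
    rw [mul_inv_rev, dualAct_mul, dualAct_mul]
    exact ⟨(hx _ (hy μ hμ).1).1, (hy _ (hx μ hμ).2).2⟩
  | inv x _ hx => exact fun μ hμ ↦ by simpa using (hx μ hμ).symm

lemma intCast_smul_dual (n : ℤ) (μ : Module.Dual ℝ V) : (n : ℝ) • μ = n • μ :=
  Int.cast_smul_eq_zsmul ℝ n μ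

variable {S : RedCrystRootSystem V}

lemma inv_eq_self_of_reflection {α : Module.Dual ℝ V} (hα : α ∈ S.R) {e : V ≃ₗ[ℝ] V}
    (he : ∀ x, e x = x - α x • S.coroot α) : e⁻¹ = e := by
  refine inv_eq_of_mul_eq_one_left ?_
  ext x
  simp only [LinearEquiv.mul_apply, he, map_sub, map_smul, S.root_coroot_two α hα, smul_eq_mul,
    LinearEquiv.coe_one, id_eq]
  module

lemma dualAct_reflection {α : Module.Dual ℝ V} (hα : α ∈ S.R) {e : V ≃ₗ[ℝ] V}
    (he : ∀ x, e x = x - α x • S.coroot α) (μ : Module.Dual ℝ V) :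
    dualAct e μ = μ - μ (S.coroot α) • α := by
  ext x
  simp only [dualAct, inv_eq_self_of_reflection hα he, LinearMap.comp_apply, LinearEquiv.coe_coe,
    he, map_sub, map_smul, smul_eq_mul, LinearMap.sub_apply, LinearMap.smul_apply]
  ring

lemma exists_reflection {α : Module.Dual ℝ V} (hα : α ∈ S.R) :
    ∃ e ∈ S.weylGroup, ∀ x, e x = x - α x • S.coroot α :=
  have h : ∀ x, Module.reflection (S.root_coroot_two α hα) x = x - α x • S.coroot α :=
    fun _ ↦ Module.reflection_apply _ _
  ⟨_, Subgroup.subset_closure ⟨α, hα, h⟩, h⟩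

lemma neg_mem {α : Module.Dual ℝ V} (hα : α ∈ S.R) : -α ∈ S.R := by
  have h := S.refl_root_mem α hα α hα
  rwa [S.root_coroot_two α hα, two_smul, sub_add_cancel_left] at h

lemma ne_neg {α : Module.Dual ℝ V} (hα : α ∈ S.R) : α ≠ -α := fun h ↦ by
  have h1 := S.root_coroot_two α hα
  have h2 := LinearMap.congr_fun h (S.coroot α)
  rw [LinearMap.neg_apply, h1] at h2
  norm_num at h2

lemma dualAct_mem_R {w : V ≃ₗ[ℝ] V} (hw : w ∈ S.weylGroup) {β : Module.Dual ℝ V}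
    (hβ : β ∈ S.R) : dualAct w β ∈ S.R := by
  refine dualAct_mem_of_mem_closure (X := S.R) ?_ ?_ hw β hβ
  · rintro e ⟨α, hα, he⟩
    exact inv_eq_self_of_reflection hα he
  · rintro e ⟨α, hα, he⟩ μ hμ
    rw [dualAct_reflection hα he]
    exact S.refl_root_mem α hα μ hμ

/-- `Λ` contains the roots and pairs integrally with the coroots. -/
def IsWeightLattice (S : RedCrystRootSystem V) (Λ : AddSubgroup (Module.Dual ℝ V)) : Prop :=
  (∀ α ∈ S.R, α ∈ Λ) ∧ ∀ μ ∈ Λ, ∀ α ∈ S.R, ∃ n : ℤ, μ (S.coroot α) = (n : ℝ)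

variable {Λ : AddSubgroup (Module.Dual ℝ V)}

lemma IsWeightLattice.dualAct_mem (hΛ : S.IsWeightLattice Λ) {w : V ≃ₗ[ℝ] V}
    (hw : w ∈ S.weylGroup) {μ : Module.Dual ℝ V} (hμ : μ ∈ Λ) : dualAct w μ ∈ Λ := by
  refine dualAct_mem_of_mem_closure (X := Λ) ?_ ?_ hw μ hμ
  · rintro e ⟨α, hα, he⟩
    exact inv_eq_self_of_reflection hα he
  · rintro e ⟨α, hα, he⟩ μ hμ
    obtain ⟨n, hn⟩ := hΛ.2 μ hμ α hα
    rw [dualAct_reflection hα he, hn, intCast_smul_dual]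
    exact Λ.sub_mem hμ (Λ.zsmul_mem (hΛ.1 α hα) n)

section Parabolic

variable {Δ S₀ : Finset (Module.Dual ℝ V)}

lemma sum_neg_smul (c : Module.Dual ℝ V → ℤ) :
    ∑ α ∈ Δ, (((-c) α : ℤ) : ℝ) • α = -∑ α ∈ Δ, (c α : ℝ) • α := by
  rw [← Finset.sum_neg_distrib]
  refine Finset.sum_congr rfl fun α _ ↦ ?_
  rw [Pi.neg_apply, Int.cast_neg]
  exact neg_smul (c α : ℝ) α

lemma parabolic_le_weylGroup (hS₀ : S₀ ⊆ S.R) : S.parabolic S₀ ≤ S.weylGroup :=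
  Subgroup.closure_mono fun _ ⟨α, hα, he⟩ ↦ ⟨α, hS₀ hα, he⟩

lemma IsBase.coeff_unique (hΔ : S.IsBase Δ) {c c' : Module.Dual ℝ V → ℝ}
    (h : ∑ α ∈ Δ, c α • α = ∑ α ∈ Δ, c' α • α) : ∀ α ∈ Δ, c α = c' α := by
  have hli : LinearIndepOn ℝ id (Δ : Set (Module.Dual ℝ V)) := hΔ.2.1
  intro α hα
  have := linearIndepOn_finset_iff.1 hli (fun α ↦ c α - c' α)
    (by simp [sub_smul, Finset.sum_sub_distrib, h]) α hα
  exact sub_eq_zero.1 this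

lemma mem_negRoots_iff {β : Module.Dual ℝ V} : β ∈ S.negRoots Δ ↔ β ∈ S.R ∧
    ∃ c : Module.Dual ℝ V → ℤ, β = ∑ α ∈ Δ, (c α : ℝ) • α ∧ ∀ α ∈ Δ, c α ≤ 0 := by
  constructor
  · rintro ⟨hβ, -, c, hc, hpos⟩
    exact ⟨hβ, -c, by rw [sum_neg_smul, ← hc, neg_neg], by simpa using hpos⟩
  · rintro ⟨hβ, c, hc, hneg⟩
    exact ⟨hβ, neg_mem hβ, -c, by rw [sum_neg_smul, ← hc], by simpa using hneg⟩

lemma IsBase.neg_notMem_negRoots (hΔ : S.IsBase Δ) {β : Module.Dual ℝ V}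
    (hβ : β ∈ S.negRoots Δ) : -β ∉ S.negRoots Δ := by
  intro hβ'
  obtain ⟨hβR, c, hc, hneg⟩ := mem_negRoots_iff.1 hβ
  obtain ⟨-, -, c', hc', hpos⟩ := hβ'
  rw [neg_neg] at hc'
  refine S.ne_zero β hβR ?_
  have := hΔ.coeff_unique (hc.symm.trans hc')
  rw [hc]
  refine Finset.sum_eq_zero fun α hα ↦ ?_
  have h1 : c α = c' α := by exact_mod_cast this α hα
  have h2 : c α = 0 := le_antisymm (hneg α hα) (h1 ▸ hpos α hα)
  simp [h2]

/-- A simple reflection in `S₀` preserves the negative roots outside the span of `S₀`. -/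
lemma IsBase.sub_smul_mem_negRoots (hΔ : S.IsBase Δ) (hS₀ : S₀ ⊆ Δ) {α β : Module.Dual ℝ V}
    (hα : α ∈ S₀) (hβ : β ∈ S.negRoots Δ)
    (hβ₀ : β ∉ AddSubgroup.closure (S₀ : Set (Module.Dual ℝ V))) :
    β - β (S.coroot α) • α ∈ S.negRoots Δ ∧
      β - β (S.coroot α) • α ∉ AddSubgroup.closure (S₀ : Set (Module.Dual ℝ V)) := by
  classical
  have hαR : α ∈ S.R := hΔ.1 (hS₀ hα)
  have hγ := S.refl_root_mem α hαR β hβ.1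
  obtain ⟨n, hn⟩ := S.crystallographic α hαR β hβ.1
  rw [hn] at hγ ⊢
  have hα₀ := AddSubgroup.subset_closure (k := (S₀ : Set (Module.Dual ℝ V))) hα
  refine ⟨mem_negRoots_iff.2 ⟨hγ, (hΔ.2.2 _ hγ).resolve_left ?_⟩, fun h ↦ hβ₀ ?_⟩
  · rintro ⟨c', hc', hpos⟩
    obtain ⟨-, c, hc, hneg⟩ := mem_negRoots_iff.1 hβ
    refine hβ₀ ?_
    have hsum : ∑ γ ∈ Δ, (c γ : ℝ) • γ =
        ∑ γ ∈ Δ, ((c' γ : ℝ) + if γ = α then (n : ℝ) else 0) • γ := by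
      rw [← hc]
      simp only [add_smul, Finset.sum_add_distrib, ← hc', ite_smul, zero_smul,
        Finset.sum_ite_eq', hS₀ hα, if_true, sub_add_cancel]
    have hcoeff := hΔ.coeff_unique hsum
    rw [hc]
    refine AddSubgroup.sum_mem _ fun γ hγ ↦ ?_
    rw [intCast_smul_dual]
    by_cases hγα : γ = α
    · exact AddSubgroup.zsmul_mem _ (hγα ▸ hα₀) _
    · have h1 : c γ = c' γ := by
        have := hcoeff γ hγ
        simp only [hγα, if_false, add_zero] at this
        exact_mod_cast this
      have h2 : c γ = 0 := le_antisymm (hneg γ hγ) (h1 ▸ hpos γ hγ)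
      simp [h2]
  · have := AddSubgroup.add_mem _ h (AddSubgroup.zsmul_mem _ hα₀ n)
    rwa [← intCast_smul_dual, sub_add_cancel] at this

lemma IsBase.dualAct_parabolic_mem (hΔ : S.IsBase Δ) (hS₀ : S₀ ⊆ Δ) {u : V ≃ₗ[ℝ] V}
    (hu : u ∈ S.parabolic S₀) {β : Module.Dual ℝ V}
    (hβ : β ∈ {β | β ∈ S.negRoots Δ ∧
      β ∉ AddSubgroup.closure (S₀ : Set (Module.Dual ℝ V))}) :
    dualAct u β ∈ {β | β ∈ S.negRoots Δ ∧
      β ∉ AddSubgroup.closure (S₀ : Set (Module.Dual ℝ V))} := by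
  refine dualAct_mem_of_mem_closure ?_ ?_ hu β hβ
  · rintro e ⟨α, hα, he⟩
    exact inv_eq_self_of_reflection (hΔ.1 (hS₀ hα)) he
  · rintro e ⟨α, hα, he⟩ μ ⟨hμ, hμ₀⟩
    rw [dualAct_reflection (hΔ.1 (hS₀ hα)) he]
    exact hΔ.sub_smul_mem_negRoots hS₀ hα hμ hμ₀

end Parabolic

section Action

variable {Q : Type*} [Field Q] [Algebra (AddMonoidAlgebra ℤ Λ) Q]
  {act : (V ≃ₗ[ℝ] V) → (Q ≃+* Q)}

/-- `act` restricts, on Weyl group elements and the group ring of `Λ`, to `e^μ ↦ e^{μ ∘ w⁻¹}`. -/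
def ExtendsWeylAction (S : RedCrystRootSystem V) (Λ : AddSubgroup (Module.Dual ℝ V))
    {Q : Type*} [Field Q] [Algebra (AddMonoidAlgebra ℤ Λ) Q]
    (act : (V ≃ₗ[ℝ] V) → (Q ≃+* Q)) : Prop :=
  ∀ w ∈ S.weylGroup, ∀ μ ∈ Λ,
    act w (algebraMap (AddMonoidAlgebra ℤ Λ) Q (expElt Λ μ)) =
      algebraMap (AddMonoidAlgebra ℤ Λ) Q (expElt Λ (dualAct w μ))

lemma ExtendsWeylAction.act_mul [IsFractionRing (AddMonoidAlgebra ℤ Λ) Q]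
    (hact : S.ExtendsWeylAction Λ act) (hΛ : S.IsWeightLattice Λ) {w w' : V ≃ₗ[ℝ] V}
    (hw : w ∈ S.weylGroup) (hw' : w' ∈ S.weylGroup) (x : Q) :
    act (w * w') x = act w (act w' x) := by
  have : (act (w * w') : Q →+* Q) = (act w : Q →+* Q).comp (act w' : Q →+* Q) := by
    refine IsLocalization.ringHom_ext (nonZeroDivisors (AddMonoidAlgebra ℤ Λ)) ?_
    refine AddMonoidAlgebra.ringHom_ext' (RingHom.ext_int _ _) (MonoidHom.ext fun μ ↦ ?_)
    have hμ := μ.toAdd.2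
    have h := expElt_of_mem hμ
    change act (w * w') (algebraMap _ Q (AddMonoidAlgebra.single (⟨μ.toAdd, hμ⟩ : Λ) 1)) =
      act w (act w' (algebraMap _ Q (AddMonoidAlgebra.single (⟨μ.toAdd, hμ⟩ : Λ) 1)))
    rw [← h]
    rw [hact _ (mul_mem hw hw') _ hμ, hact _ hw' _ hμ, hact _ hw _ (hΛ.dualAct_mem hw' hμ),
      dualAct_mul]
  exact congrArg (fun g : Q →+* Q ↦ g x) this

lemma ExtendsWeylAction.algebraMap_mem_range (hact : S.ExtendsWeylAction Λ act)
    {w : V ≃ₗ[ℝ] V} (hw : w ∈ S.weylGroup) (f : AddMonoidAlgebra ℤ Λ) :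
    act w (algebraMap _ Q f) ∈ (algebraMap (AddMonoidAlgebra ℤ Λ) Q).range :=
  AddMonoidAlgebra.mem_addSubgroup_of_single_mem (G := Λ)
    (((algebraMap (AddMonoidAlgebra ℤ Λ) Q).range.toAddSubgroup).comap
      (((act w : Q →+* Q).comp (algebraMap (AddMonoidAlgebra ℤ Λ) Q) : _ →+* Q) : AddMonoidAlgebra ℤ Λ →+ Q))
    (fun μ : Λ ↦ ⟨expElt Λ (dualAct w μ), by simp [← hact w hw μ μ.2, expElt_of_mem μ.2]⟩) f

open scoped Classical in
lemma ExtendsWeylAction.prod_one_sub_expElt (hact : S.ExtendsWeylAction Λ act)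
    (hΛ : S.IsWeightLattice Λ) {w : V ≃ₗ[ℝ] V} (hw : w ∈ S.weylGroup)
    {T : Finset (Module.Dual ℝ V)} (hT : T ⊆ S.R) :
    act w (algebraMap _ Q (∏ β ∈ T, (1 - expElt Λ β))) =
      algebraMap _ Q (∏ β ∈ T.image (dualAct w), (1 - expElt Λ β)) := by
  rw [Finset.prod_image (dualAct_injective w).injOn]
  simp only [map_prod, map_sub, map_one]
  exact Finset.prod_congr rfl fun β hβ ↦ by rw [hact w hw β (hΛ.1 β (hT hβ))]

/-- The reflection in `α` acts trivially modulo `1 - e^α`. -/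
lemma ExtendsWeylAction.exists_reflection_sub (hact : S.ExtendsWeylAction Λ act)
    (hΛ : S.IsWeightLattice Λ) {α : Module.Dual ℝ V} (hα : α ∈ S.R) {e : V ≃ₗ[ℝ] V}
    (he : e ∈ S.weylGroup) (heα : ∀ x, e x = x - α x • S.coroot α)
    (h : AddMonoidAlgebra ℤ Λ) :
    ∃ y, act e (algebraMap _ Q h) = algebraMap _ Q (h - (1 - expElt Λ α) * y) := by
  have := AddMonoidAlgebra.mem_addSubgroup_of_single_mem (G := Λ)
    (((Ideal.span {1 - expElt Λ α}).toAddSubgroup.map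
      ((algebraMap (AddMonoidAlgebra ℤ Λ) Q : _ →+* Q) : _ →+ Q)).comap
      (((algebraMap (AddMonoidAlgebra ℤ Λ) Q : _ →+* Q) : _ →+ Q) -
        (((act e : Q →+* Q).comp (algebraMap (AddMonoidAlgebra ℤ Λ) Q) : _ →+* Q) : _ →+ Q)))
    (fun μ ↦ ?_) h
  · obtain ⟨z, hz, hz'⟩ := this
    obtain ⟨y, rfl⟩ := Ideal.mem_span_singleton.1 hz
    refine ⟨y, ?_⟩
    simp only [AddMonoidHom.coe_coe, AddMonoidHom.sub_apply, RingHom.comp_apply,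
      RingHom.coe_coe] at hz'
    rw [map_sub (algebraMap _ Q), hz', sub_sub_cancel]
  · refine ⟨AddMonoidAlgebra.single μ 1 - expElt Λ (dualAct e μ), Ideal.mem_span_singleton.2 ?_, ?_⟩
    · rw [expElt_of_mem (hΛ.1 α hα), expElt_of_mem (hΛ.dualAct_mem he μ.2)]
      obtain ⟨n, hn⟩ := hΛ.2 μ μ.2 α hα
      refine AddMonoidAlgebra.one_sub_single_dvd_single_sub_single
        (AddSubgroup.mem_zmultiples_iff.2 ⟨n, Subtype.ext ?_⟩)
      simp [dualAct_reflection hα heα, hn, intCast_smul_dual]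
    · simp [← hact e he μ μ.2, expElt_of_mem μ.2]

open scoped Classical in
/-- A Weyl-invariant element has no pole along `1 - e^α` if it has at most a simple one. -/
lemma ExtendsWeylAction.mul_prod_mem_range [IsFractionRing (AddMonoidAlgebra ℤ Λ) Q]
    (hact : S.ExtendsWeylAction Λ act) (hΛ : S.IsWeightLattice Λ) {E : Q}
    (hE : ∀ w ∈ S.weylGroup, act w E = E) {α : Module.Dual ℝ V} (hα : α ∈ S.R)
    (h : E * algebraMap _ Q (∏ β ∈ S.R.erase (-α), (1 - expElt Λ β)) ∈
      (algebraMap (AddMonoidAlgebra ℤ Λ) Q).range) :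
    E * algebraMap _ Q (∏ β ∈ (S.R.erase (-α)).erase α, (1 - expElt Λ β)) ∈
      (algebraMap (AddMonoidAlgebra ℤ Λ) Q).range := by
  have hinj := IsFractionRing.injective (AddMonoidAlgebra ℤ Λ) Q
  have hαΛ := hΛ.1 α hα
  obtain ⟨e, he, heα⟩ := exists_reflection hα
  have hdα : dualAct e α = -α := by
    rw [dualAct_reflection hα heα, S.root_coroot_two α hα]
    module
  have himage : ((S.R.erase (-α)).erase α).image (dualAct e) = (S.R.erase (-α)).erase α := by
    refine Finset.eq_of_subset_of_card_le (fun β hβ ↦ ?_)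
      (Finset.card_image_of_injective _ (dualAct_injective e)).ge
    obtain ⟨γ, hγ, rfl⟩ := Finset.mem_image.1 hβ
    simp only [Finset.mem_erase] at hγ ⊢
    refine ⟨fun h ↦ hγ.2.1 (dualAct_injective e ?_), fun h ↦ hγ.1 (dualAct_injective e ?_),
      dualAct_mem_R he hγ.2.2⟩
    · rw [h, dualAct_neg, hdα, neg_neg]
    · rw [h, hdα]
  rw [← Finset.mul_prod_erase _ _ (Finset.mem_erase.2 ⟨ne_neg hα, hα⟩), map_mul] at h
  obtain ⟨x, hx⟩ := h
  obtain ⟨y, hy⟩ := hact.exists_reflection_sub hΛ hα he heα x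
  have hneg : act e (algebraMap _ Q x) = algebraMap _ Q (-expElt Λ (-α) * x) := by
    rw [hx, map_mul, map_mul, hE e he, hact.prod_one_sub_expElt hΛ he
      ((Finset.erase_subset _ _).trans (Finset.erase_subset _ _)), himage, map_sub (algebraMap _ Q),
      map_sub (act e), hact e he α hαΛ, hdα, map_one, map_one, map_mul, hx,
      ← map_one (algebraMap (AddMonoidAlgebra ℤ Λ) Q), ← map_sub, one_sub_expElt_neg hαΛ, map_mul]
    ring
  have hxy := hinj (hy.symm.trans hneg)
  have hdvd : 1 - expElt Λ α ∣ 2 * x := by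
    refine ⟨y - expElt Λ (-α) * x, ?_⟩
    have := one_sub_expElt_neg hαΛ
    linear_combination hxy + x * this
  rw [expElt_of_mem hαΛ] at hdvd
  obtain ⟨z, hz⟩ := AddMonoidAlgebra.one_sub_single_dvd_of_dvd_two_mul hdvd
  rw [← expElt_of_mem hαΛ] at hz
  refine ⟨z, mul_left_cancel₀ ((map_ne_zero_iff _ hinj).2
    (one_sub_expElt_ne_zero hαΛ (S.ne_zero α hα))) ?_⟩
  rw [← map_mul, ← hz, hx]
  ring

open scoped Classical in
lemma IsWeightLattice.prod_dvd_prod_erase_neg (hΛ : S.IsWeightLattice Λ)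
    {T : Finset (Module.Dual ℝ V)} (hT : T ⊆ S.R) (hT' : ∀ β ∈ T, -β ∉ T) {α : Module.Dual ℝ V}
    (hα : α ∈ S.R) :
    ∏ β ∈ T, (1 - expElt Λ β) ∣ ∏ β ∈ S.R.erase (-α), (1 - expElt Λ β) := by
  by_cases h : -α ∈ T
  · rw [← Finset.mul_prod_erase T _ h,
      ← Finset.mul_prod_erase (S.R.erase (-α)) _ (Finset.mem_erase.2 ⟨ne_neg hα, hα⟩)]
    refine mul_dvd_mul (one_sub_expElt_neg_dvd (hΛ.1 α hα))
      (Finset.prod_dvd_prod_of_subset _ _ _ fun β hβ ↦ ?_)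
    simp only [Finset.mem_erase] at hβ ⊢
    refine ⟨?_, hβ.1, hT hβ.2⟩
    rintro rfl
    exact hT' β hβ.2 h
  · exact Finset.prod_dvd_prod_of_subset _ _ _ fun β hβ ↦
      Finset.mem_erase.2 ⟨fun h' ↦ h (h' ▸ hβ), hT hβ⟩

lemma IsWeightLattice.dvd_of_dvd_prod_mul (hΛ : S.IsWeightLattice Λ) {α : Module.Dual ℝ V}
    (hα : α ∈ S.R) {T : Finset (Module.Dual ℝ V)} (hT : T ⊆ S.R) (h1 : α ∉ T) (h2 : -α ∉ T)
    {x : AddMonoidAlgebra ℤ Λ} (hx : 1 - expElt Λ α ∣ (∏ β ∈ T, (1 - expElt Λ β)) * x) :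
    1 - expElt Λ α ∣ x := by
  induction T using Finset.cons_induction with
  | empty => simpa using hx
  | cons β T hβ ih =>
    rw [Finset.prod_cons, mul_assoc] at hx
    have hβR := hT (Finset.mem_cons_self β T)
    refine ih (fun γ hγ ↦ hT (Finset.mem_cons_of_mem hγ))
      (fun h ↦ h1 (Finset.mem_cons_of_mem h)) (fun h ↦ h2 (Finset.mem_cons_of_mem h))
      (one_sub_expElt_dvd_of_dvd_mul (hΛ.1 α hα) (hΛ.1 β hβR) (fun c hc ↦ ?_) hx)
    rcases S.reduced α hα β hβR c hc with rfl | rfl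
    · exact h1 (Finset.mem_cons_self _ T)
    · exact h2 (Finset.mem_cons_self _ T)

open scoped Classical in
/-- A Weyl-invariant element with denominators dividing `∏_{β ≠ -α} (1 - e^β)` for each root `α`
is integral. -/
lemma ExtendsWeylAction.mem_range_of_invariant [IsFractionRing (AddMonoidAlgebra ℤ Λ) Q]
    (hact : S.ExtendsWeylAction Λ act) (hΛ : S.IsWeightLattice Λ) {E : Q}
    (hE : ∀ w ∈ S.weylGroup, act w E = E)
    (h : ∀ α ∈ S.R, E * algebraMap _ Q (∏ β ∈ S.R.erase (-α), (1 - expElt Λ β)) ∈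
      (algebraMap (AddMonoidAlgebra ℤ Λ) Q).range)
    (h' : E * algebraMap _ Q (∏ β ∈ S.R, (1 - expElt Λ β)) ∈
      (algebraMap (AddMonoidAlgebra ℤ Λ) Q).range) :
    E ∈ (algebraMap (AddMonoidAlgebra ℤ Λ) Q).range := by
  refine mem_range_algebraMap_of_coprime_denominators (IsFractionRing.injective _ Q) S.R
    (fun β ↦ 1 - expElt Λ β) E
    (fun γ hγ ↦ one_sub_expElt_ne_zero (hΛ.1 γ hγ) (S.ne_zero γ hγ)) h' fun γ hγ ↦
      ⟨_, hact.mul_prod_mem_range hΛ hE hγ (h γ hγ), fun x hx ↦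
        hΛ.dvd_of_dvd_prod_mul hγ ((Finset.erase_subset _ _).trans (Finset.erase_subset _ _))
          (by simp) (by simp) hx⟩

open scoped Classical in
lemma ExtendsWeylAction.div_mul_mem_range [IsFractionRing (AddMonoidAlgebra ℤ Λ) Q]
    (hact : S.ExtendsWeylAction Λ act) (hΛ : S.IsWeightLattice Λ)
    {N : Finset (Module.Dual ℝ V)} (hN : N ⊆ S.R) {w : V ≃ₗ[ℝ] V} (hw : w ∈ S.weylGroup)
    (f : AddMonoidAlgebra ℤ Λ) {c : AddMonoidAlgebra ℤ Λ}
    (hc : ∏ β ∈ N.image (dualAct w), (1 - expElt Λ β) ∣ c) :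
    act w (algebraMap _ Q f / algebraMap _ Q (∏ β ∈ N, (1 - expElt Λ β))) * algebraMap _ Q c ∈
      (algebraMap (AddMonoidAlgebra ℤ Λ) Q).range := by
  have hinj := IsFractionRing.injective (AddMonoidAlgebra ℤ Λ) Q
  obtain ⟨b, rfl⟩ := hc
  have hprod : act w (algebraMap _ Q (∏ β ∈ N, (1 - expElt Λ β))) =
      algebraMap _ Q (∏ β ∈ N.image (dualAct w), (1 - expElt Λ β)) :=
    hact.prod_one_sub_expElt hΛ hw hN
  have hne : algebraMap _ Q (∏ β ∈ N.image (dualAct w), (1 - expElt Λ β)) ≠ 0 := by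
    rw [map_prod, Finset.prod_ne_zero_iff]
    intro β hβ
    obtain ⟨γ, hγ, rfl⟩ := Finset.mem_image.1 hβ
    have hR := dualAct_mem_R hw (hN hγ)
    exact (map_ne_zero_iff _ hinj).2 (one_sub_expElt_ne_zero (hΛ.1 _ hR) (S.ne_zero _ hR))
  rw [map_div₀, hprod, map_mul, ← mul_assoc, div_mul_cancel₀ _ hne]
  exact mul_mem (hact.algebraMap_mem_range hw f) ⟨b, rfl⟩

end Action

end RedCrystRootSystem

/-- A sum over a system of left coset representatives of a function constant on left cosets is
unchanged by left translation. -/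
lemma sum_left_mul_eq_sum_of_existsUnique_rep {G M ι : Type*} [Group G] [AddCommMonoid M]
    [Fintype ι] {W H : Subgroup G} {rep : ι → G} (hrep : ∀ i, rep i ∈ W)
    (huniq : ∀ w ∈ W, ∃! i, (rep i)⁻¹ * w ∈ H) {φ : G → M}
    (hφ : ∀ w ∈ W, ∀ w' ∈ W, w⁻¹ * w' ∈ H → φ w = φ w') {w : G} (hw : w ∈ W) :
    ∑ i, φ (w * rep i) = ∑ i, φ (rep i) := by
  choose σ hσ _ using fun i ↦ huniq (w * rep i) (W.mul_mem hw (hrep i))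
  have hinj : Function.Injective σ := fun i j hij ↦ by
    have hmem : (rep i)⁻¹ * rep j ∈ H := by
      have := H.mul_mem (H.inv_mem (hσ i)) (hij ▸ hσ j)
      simpa [mul_assoc] using this
    exact (huniq _ (hrep j)).unique hmem (by simp [H.one_mem])
  refine (Finset.sum_congr rfl fun i _ ↦ ?_).trans
    ((Finite.injective_iff_bijective.1 hinj).sum_comp fun i ↦ φ (rep i))
  exact (hφ _ (hrep _) _ (W.mul_mem hw (hrep i)) (hσ i)).symm

/-- (K-theoretic Weyl character formula, algebraic content.)
With `Δ` a base of the root system, `S₀ ⊆ Δ`, `W_H = ⟨s_α : α ∈ S₀⟩`,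
`R_H = R ∩ ℤ-span(S₀)`, `N = R₋ \ R_H`, and `Λ` a `W`-stable weight lattice
with group ring `ℤ[Λ]` (an integral domain) with fraction field `Q`, put
`D = ∏_{α ∈ N} (1 - e^α)`.  Then `D ≠ 0`, `u(D) = D` for `u ∈ W_H`, and for every
`W_H`-invariant `f ∈ ℤ[Λ]` the element `w(f·D⁻¹) ∈ Q` depends only on the coset
`w·W_H`, and `ind(f) = Σ_{[w] ∈ W/W_H} w(f·D⁻¹)` lies in the image of `ℤ[Λ]` in `Q`
and is `W`-invariant. -/
theorem statement7 {V : Type*} [AddCommGroup V] [Module ℝ V] [FiniteDimensional ℝ V]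
    (S : RedCrystRootSystem V)
    (hspan : Submodule.span ℝ (↑S.R : Set (Module.Dual ℝ V)) = ⊤)
    (Δ : Finset (Module.Dual ℝ V)) (hΔ : S.IsBase Δ)
    (S₀ : Finset (Module.Dual ℝ V)) (hS₀ : S₀ ⊆ Δ)
    -- `N = R₋ \ R_H` where `R_H = R ∩ ℤ-span(S₀)`
    (N : Finset (Module.Dual ℝ V))
    (hN : (↑N : Set (Module.Dual ℝ V)) =
      {β | β ∈ S.negRoots Δ ∧
        β ∉ AddSubgroup.closure (↑S₀ : Set (Module.Dual ℝ V))})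
    -- the weight lattice `Λ`, containing the roots and pairing integrally with coroots
    (Λ : AddSubgroup (Module.Dual ℝ V))
    (hRΛ : ∀ α ∈ S.R, α ∈ Λ)
    (hΛint : ∀ μ ∈ Λ, ∀ α ∈ S.R, ∃ n : ℤ, μ (S.coroot α) = (n : ℝ))
    -- the fraction field `Q` of `ℤ[Λ]` ...
    (Q : Type*) [Field Q] [Algebra (AddMonoidAlgebra ℤ ↥Λ) Q]
    [IsFractionRing (AddMonoidAlgebra ℤ ↥Λ) Q]
    -- ... to which the `W`-action `e^μ ↦ e^{w(μ)} = e^{μ ∘ w⁻¹}` extends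
    (act : (V ≃ₗ[ℝ] V) → (Q ≃+* Q))
    (hact : ∀ w ∈ S.weylGroup, ∀ μ ∈ Λ,
      act w (algebraMap (AddMonoidAlgebra ℤ ↥Λ) Q (expElt Λ μ)) =
        algebraMap (AddMonoidAlgebra ℤ ↥Λ) Q
          (expElt Λ (μ.comp ((w⁻¹ : V ≃ₗ[ℝ] V) : V →ₗ[ℝ] V)))) :
    -- `ℤ[Λ]` is an integral domain and `D = ∏_{α ∈ N} (1 - e^α)` is non-zero
    IsDomain (AddMonoidAlgebra ℤ ↥Λ) ∧
    (∏ α ∈ N, ((1 : AddMonoidAlgebra ℤ ↥Λ) - expElt Λ α)) ≠ 0 ∧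
    -- (i) `u(D) = D` for every `u ∈ W_H`
    (∀ u ∈ S.parabolic S₀,
      act u (algebraMap (AddMonoidAlgebra ℤ ↥Λ) Q
          (∏ α ∈ N, ((1 : AddMonoidAlgebra ℤ ↥Λ) - expElt Λ α))) =
        algebraMap (AddMonoidAlgebra ℤ ↥Λ) Q
          (∏ α ∈ N, ((1 : AddMonoidAlgebra ℤ ↥Λ) - expElt Λ α))) ∧
    -- (ii) for every `W_H`-invariant `f ∈ ℤ[Λ]`:
    ∀ f : AddMonoidAlgebra ℤ ↥Λ,
      (∀ u ∈ S.parabolic S₀,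
        act u (algebraMap (AddMonoidAlgebra ℤ ↥Λ) Q f) =
          algebraMap (AddMonoidAlgebra ℤ ↥Λ) Q f) →
      -- `w(f·D⁻¹)` depends only on the left coset `w·W_H` ...
      (∀ w w' : V ≃ₗ[ℝ] V, w ∈ S.weylGroup → w' ∈ S.weylGroup →
        w⁻¹ * w' ∈ S.parabolic S₀ →
        act w (algebraMap (AddMonoidAlgebra ℤ ↥Λ) Q f /
            algebraMap (AddMonoidAlgebra ℤ ↥Λ) Q
              (∏ α ∈ N, ((1 : AddMonoidAlgebra ℤ ↥Λ) - expElt Λ α))) =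
        act w' (algebraMap (AddMonoidAlgebra ℤ ↥Λ) Q f /
            algebraMap (AddMonoidAlgebra ℤ ↥Λ) Q
              (∏ α ∈ N, ((1 : AddMonoidAlgebra ℤ ↥Λ) - expElt Λ α)))) ∧
      -- ... and for any system `w₁, …, w_m` of representatives of the left cosets
      -- `W/W_H`, the sum `Σᵢ wᵢ(f·D⁻¹)` lies in the image of `ℤ[Λ]` and is
      -- `W`-invariant.
      ∀ (m : ℕ) (rep : Fin m → (V ≃ₗ[ℝ] V)),
        (∀ i, rep i ∈ S.weylGroup) →
        (∀ w ∈ S.weylGroup, ∃! i, (rep i)⁻¹ * w ∈ S.parabolic S₀) →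
        (∃ g : AddMonoidAlgebra ℤ ↥Λ,
          algebraMap (AddMonoidAlgebra ℤ ↥Λ) Q g =
            ∑ i, act (rep i) (algebraMap (AddMonoidAlgebra ℤ ↥Λ) Q f /
              algebraMap (AddMonoidAlgebra ℤ ↥Λ) Q
                (∏ α ∈ N, ((1 : AddMonoidAlgebra ℤ ↥Λ) - expElt Λ α)))) ∧
        (∀ w ∈ S.weylGroup,
          act w (∑ i, act (rep i) (algebraMap (AddMonoidAlgebra ℤ ↥Λ) Q f /
              algebraMap (AddMonoidAlgebra ℤ ↥Λ) Q
                (∏ α ∈ N, ((1 : AddMonoidAlgebra ℤ ↥Λ) - expElt Λ α)))) =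
            ∑ i, act (rep i) (algebraMap (AddMonoidAlgebra ℤ ↥Λ) Q f /
              algebraMap (AddMonoidAlgebra ℤ ↥Λ) Q
                (∏ α ∈ N, ((1 : AddMonoidAlgebra ℤ ↥Λ) - expElt Λ α)))) := by
  classical
  have hΛ : S.IsWeightLattice Λ := ⟨hRΛ, hΛint⟩
  replace hact : S.ExtendsWeylAction Λ act := hact
  have hinj := IsFractionRing.injective (AddMonoidAlgebra ℤ Λ) Q
  have hmemN : ∀ β, β ∈ N ↔ β ∈ S.negRoots Δ ∧
      β ∉ AddSubgroup.closure (S₀ : Set (Module.Dual ℝ V)) := fun β ↦ Set.ext_iff.1 hN β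
  have hNR : N ⊆ S.R := fun β hβ ↦ ((hmemN β).1 hβ).1.1
  have hNneg : ∀ β ∈ N, -β ∉ N := fun β hβ hβ' ↦
    hΔ.neg_notMem_negRoots ((hmemN β).1 hβ).1 ((hmemN _).1 hβ').1
  have hle : S.parabolic S₀ ≤ S.weylGroup :=
    RedCrystRootSystem.parabolic_le_weylGroup fun _ hα ↦ hΔ.1 (hS₀ hα)
  have hD : ∀ u ∈ S.parabolic S₀,
      act u (algebraMap _ Q (∏ α ∈ N, ((1 : AddMonoidAlgebra ℤ Λ) - expElt Λ α))) =
        algebraMap _ Q (∏ α ∈ N, ((1 : AddMonoidAlgebra ℤ Λ) - expElt Λ α)) := by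
    intro u hu
    have himage : N.image (RedCrystRootSystem.dualAct u) = N := by
      refine Finset.eq_of_subset_of_card_le (fun β hβ ↦ ?_)
        (Finset.card_image_of_injective _ (RedCrystRootSystem.dualAct_injective u)).ge
      obtain ⟨γ, hγ, rfl⟩ := Finset.mem_image.1 hβ
      exact (hmemN _).2 (hΔ.dualAct_parabolic_mem hS₀ hu ((hmemN γ).1 hγ))
    conv_rhs => rw [← himage]
    exact hact.prod_one_sub_expElt hΛ (hle hu) hNR
  have hdom : IsDomain (AddMonoidAlgebra ℤ Λ) := hinj.isDomain
  refine ⟨hdom, Finset.prod_ne_zero_iff.2 fun β hβ ↦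
    one_sub_expElt_ne_zero (hRΛ β (hNR hβ)) (S.ne_zero β (hNR hβ)), hD, fun f hf ↦ ?_⟩
  set y : Q := algebraMap _ Q f /
    algebraMap _ Q (∏ α ∈ N, ((1 : AddMonoidAlgebra ℤ Λ) - expElt Λ α)) with hy
  have hyfix : ∀ u ∈ S.parabolic S₀, act u y = y := fun u hu ↦ by
    rw [hy, map_div₀, hf u hu, hD u hu]
  have hcoset : ∀ w ∈ S.weylGroup, ∀ w' ∈ S.weylGroup, w⁻¹ * w' ∈ S.parabolic S₀ →
      act w y = act w' y := fun w hw w' hw' h ↦ by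
    conv_rhs => rw [← mul_inv_cancel_left w w', hact.act_mul hΛ hw (hle h), hyfix _ h]
  refine ⟨fun w w' hw hw' h ↦ hcoset w hw w' hw' h, fun m rep hrep huniq ↦ ?_⟩
  have hinv : ∀ w ∈ S.weylGroup, act w (∑ i, act (rep i) y) = ∑ i, act (rep i) y := by
    intro w hw
    rw [map_sum, ← sum_left_mul_eq_sum_of_existsUnique_rep hrep huniq (φ := fun w ↦ act w y)
      hcoset hw]
    exact Finset.sum_congr rfl fun i _ ↦ (hact.act_mul hΛ hw (hrep i) y).symm
  have himageR : ∀ i, N.image (RedCrystRootSystem.dualAct (rep i)) ⊆ S.R := fun i ↦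
    Finset.image_subset_iff.2 fun β hβ ↦ RedCrystRootSystem.dualAct_mem_R (hrep i) (hNR hβ)
  refine ⟨hact.mem_range_of_invariant hΛ hinv (fun α hα ↦ ?_) ?_, hinv⟩
  · rw [Finset.sum_mul]
    refine sum_mem fun i _ ↦ hact.div_mul_mem_range hΛ hNR (hrep i) f ?_
    refine hΛ.prod_dvd_prod_erase_neg (himageR i) (fun β hβ hβ' ↦ ?_) hα
    obtain ⟨γ, hγ, rfl⟩ := Finset.mem_image.1 hβ
    obtain ⟨δ, hδ, hδγ⟩ := Finset.mem_image.1 hβ'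
    rw [← RedCrystRootSystem.dualAct_neg] at hδγ
    exact hNneg γ hγ (RedCrystRootSystem.dualAct_injective _ hδγ ▸ hδ)
  · rw [Finset.sum_mul]
    exact sum_mem fun i _ ↦ hact.div_mul_mem_range hΛ hNR (hrep i) f
      (Finset.prod_dvd_prod_of_subset _ _ _ (himageR i))
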